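/- (Mehler's formula.) Let H_k(x) := (−1)^k e^{x²} · (d^k/dx^k)(e^{−x²}) be the k-th physicists' Hermite polynomial and h_k := (2^k k!)^{−1/2} H_k the normalized Hermite polynomial. Then for every z ∈ ℂ with Re z > 0 and all x, y ∈ ℝ, the series Σ_{k=0}^∞ e^{−kz} h_k(x) h_k(y) converges absolutely and Σ_{k=0}^∞ e^{−kz} h_k(x) h_k(y) = (1 − e^{−2z})^{−1/2} · exp( ( (1 − coth z)(x² + y²) + 2xy/ sinh z ) / 2 ), where ζ^{−1/2} is the principal branch (note Re(1 − e^{−2z}) > 0 when Re z > 0). -/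

import Mathlib

noncomputable section

open MeasureTheory Real Complex

/-- The `k`-th physicists' Hermite polynomial
`H_k(x) = (-1)^k e^{x²} (d^k/dx^k)(e^{-x²})`. -/
def physHermite (k : ℕ) (x : ℝ) : ℝ :=
  (-1 : ℝ) ^ k * Real.exp (x ^ 2) * iteratedDeriv k (fun t : ℝ => Real.exp (-t ^ 2)) x

/-- The normalized Hermite polynomial `h_k = (2^k k!)^{-1/2} H_k`. -/
def normHermite (k : ℕ) (x : ℝ) : ℝ :=
  physHermite k x / Real.sqrt (2 ^ k * Nat.factorial k)

open scoped FourierTransform Nat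

theorem iteratedDeriv_ofReal_comp {f : ℝ → ℝ} {k : ℕ} (hf : ContDiff ℝ k f) (x : ℝ) :
    iteratedDeriv k (fun t => (f t : ℂ)) x = ((iteratedDeriv k f x : ℝ) : ℂ) := by
  have h := ofRealCLM.iteratedFDeriv_comp_left (i := k) (hf.contDiffAt (x := x)) le_rfl
  have := congrArg (fun g => g fun _ => (1 : ℝ)) h
  simpa [iteratedDeriv, Function.comp_def] using this

theorem integrable_pow_mul_exp_neg_mul_sq (n : ℕ) {b : ℝ} (hb : 0 < b) :
    Integrable fun t : ℝ => t ^ n * Real.exp (-b * t ^ 2) := by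
  simpa using integrable_rpow_mul_exp_neg_mul_sq hb (s := n) (by linarith [n.cast_nonneg (α := ℝ)])

theorem physHermite_eq_integral (k : ℕ) (x : ℝ) :
    (physHermite k x : ℂ) = (√π : ℂ) * cexp (x ^ 2) *
      ∫ t : ℝ, (2 * π * I * t) ^ k * cexp (-π ^ 2 * t ^ 2 - 2 * π * I * x * t) := by
  have hπ : (√π : ℂ) ≠ 0 := by exact_mod_cast (Real.sqrt_pos.2 Real.pi_pos).ne'
  have hgauss : (fun u : ℝ => ((Real.exp (-u ^ 2) : ℝ) : ℂ)) =
      𝓕 fun t : ℝ => (√π : ℂ) * cexp (-π * π * t ^ 2) := by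
    have h := fourier_gaussian_pi (b := π) (by simpa using Real.pi_pos)
    have hs : (π : ℂ) ^ (1 / 2 : ℂ) = (√π : ℂ) := by
      rw [Real.sqrt_eq_rpow, ofReal_cpow Real.pi_pos.le]; norm_num
    ext u
    have hu := congrFun h u
    rw [Real.fourier_real_eq_integral_exp_smul] at hu ⊢
    simp only [smul_eq_mul] at hu ⊢
    simp_rw [mul_left_comm _ (√π : ℂ)]
    rw [integral_const_mul, hu, hs, ← mul_assoc, mul_one_div_cancel hπ, neg_div,
      div_self (by exact_mod_cast Real.pi_ne_zero)]
    push_cast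
    ring_nf
  have hint : ∀ n : ℕ, n ≤ (⊤ : ℕ∞) →
      Integrable fun t : ℝ => t ^ n • ((√π : ℂ) * cexp (-π * π * t ^ 2)) := by
    intro n _
    have := (integrable_pow_mul_exp_neg_mul_sq n (b := π * π) (by positivity)).ofReal (𝕜 := ℂ)
    convert! this.const_mul (√π : ℂ) using 2 with t
    simp only [real_smul, coe_algebraMap, ofReal_mul]
    push_cast
    ring_nf
  have hderiv : ((iteratedDeriv k (fun t : ℝ => Real.exp (-t ^ 2)) x : ℝ) : ℂ) =
      (√π : ℂ) * ∫ t : ℝ, (-2 * π * I * t) ^ k * cexp (-π ^ 2 * t ^ 2 - 2 * π * I * x * t) := by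
    rw [← iteratedDeriv_ofReal_comp (by fun_prop), hgauss,
      Real.iteratedDeriv_fourier hint le_top, Real.fourier_real_eq_integral_exp_smul,
      ← integral_const_mul]
    congr 1 with t
    rw [sub_eq_add_neg, Complex.exp_add]
    simp only [smul_eq_mul]
    push_cast
    ring_nf
  have hsign : ∫ t : ℝ, (2 * π * I * t) ^ k * cexp (-π ^ 2 * t ^ 2 - 2 * π * I * x * t) =
      (-1) ^ k * ∫ t : ℝ, (-2 * π * I * t) ^ k * cexp (-π ^ 2 * t ^ 2 - 2 * π * I * x * t) := by
    rw [← integral_const_mul]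
    congr! 2 with t
    rw [← mul_assoc, ← mul_pow]
    ring_nf
  rw [physHermite, hsign]
  push_cast
  rw [hderiv]
  ring

/-- The `k`-th term of the expansion in `w` of the double Fourier integral of Mehler's kernel. -/
def mehlerIntegrand (w : ℂ) (x y : ℝ) (k : ℕ) (p : ℝ × ℝ) : ℂ :=
  (-2 * π ^ 2 * w * p.1 * p.2) ^ k / k ! *
    cexp (-π ^ 2 * (p.1 ^ 2 + p.2 ^ 2) - 2 * π * I * (x * p.1 + y * p.2))

theorem integral_mehlerIntegrand (w : ℂ) (x y : ℝ) (k : ℕ) :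
    π * cexp (x ^ 2 + y ^ 2) * ∫ p, mehlerIntegrand w x y k p =
      w ^ k * normHermite k x * normHermite k y := by
  have hfac : ((√(2 ^ k * k !) : ℝ) : ℂ) ^ 2 = 2 ^ k * k ! := by
    rw [← ofReal_pow, Real.sq_sqrt (by positivity)]; push_cast; rfl
  have hk : (k ! : ℂ) ≠ 0 := by exact_mod_cast k.factorial_ne_zero
  have hπ : (√π : ℂ) ^ 2 = π := by
    rw [← ofReal_pow, Real.sq_sqrt Real.pi_pos.le]
  have hfactor : ∫ p, mehlerIntegrand w x y k p = w ^ k / (2 ^ k * k !) *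
      ((∫ s : ℝ, (2 * π * I * s) ^ k * cexp (-π ^ 2 * s ^ 2 - 2 * π * I * x * s)) *
        ∫ t : ℝ, (2 * π * I * t) ^ k * cexp (-π ^ 2 * t ^ 2 - 2 * π * I * y * t)) := by
    rw [← integral_prod_mul, ← integral_const_mul]
    congr 1 with p
    have hexp : cexp (-π ^ 2 * (p.1 ^ 2 + p.2 ^ 2) - 2 * π * I * (x * p.1 + y * p.2)) =
        cexp (-π ^ 2 * p.1 ^ 2 - 2 * π * I * x * p.1) *
          cexp (-π ^ 2 * p.2 ^ 2 - 2 * π * I * y * p.2) := by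
      rw [← Complex.exp_add]; ring_nf
    have hbase : -2 * π ^ 2 * w * p.1 * p.2 =
        w * (2 * π * I * p.1) * (2 * π * I * p.2) / 2 := by
      linear_combination (-2 * π ^ 2 * w * p.1 * p.2 : ℂ) * I_sq
    rw [mehlerIntegrand, hexp, hbase, div_pow, mul_pow, mul_pow w]
    field_simp
  rw [normHermite, normHermite, ofReal_div, ofReal_div, physHermite_eq_integral,
    physHermite_eq_integral, hfactor, Complex.exp_add, ← hfac, ← hπ]
  have hne : ((√(2 ^ k * k !) : ℝ) : ℂ) ≠ 0 := by
    exact_mod_cast (Real.sqrt_pos.2 (by positivity)).ne'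
  field_simp

theorem norm_exp_mehler_phase (x y s t : ℝ) :
    ‖cexp (-π ^ 2 * (s ^ 2 + t ^ 2) - 2 * π * I * (x * s + y * t))‖ =
      Real.exp (-π ^ 2 * (s ^ 2 + t ^ 2)) := by
  have : (-π ^ 2 * (s ^ 2 + t ^ 2) - 2 * π * I * (x * s + y * t) : ℂ) =
      ((-π ^ 2 * (s ^ 2 + t ^ 2) : ℝ) : ℂ) + ((-2 * π * (x * s + y * t) : ℝ) : ℂ) * I := by
    push_cast; ring
  rw [this, Complex.norm_exp, add_re, ofReal_re, re_ofReal_mul, I_re, mul_zero, add_zero]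

theorem hasSum_mehlerIntegrand (w : ℂ) (x y : ℝ) (p : ℝ × ℝ) :
    HasSum (fun k => mehlerIntegrand w x y k p)
      (cexp (-π ^ 2 * (p.1 ^ 2 + p.2 ^ 2) - 2 * π ^ 2 * w * p.1 * p.2 -
        2 * π * I * (x * p.1 + y * p.2))) := by
  have h := (NormedSpace.expSeries_div_hasSum_exp (-2 * π ^ 2 * w * p.1 * p.2)).mul_right
    (cexp (-π ^ 2 * (p.1 ^ 2 + p.2 ^ 2) - 2 * π * I * (x * p.1 + y * p.2)))
  rw [← Complex.exp_eq_exp_ℂ, ← Complex.exp_add] at h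
  convert! h using 2
  ring

theorem sum_norm_mehlerIntegrand_le (w : ℂ) (x y : ℝ) (p : ℝ × ℝ) (n : ℕ) :
    ∑ k ∈ Finset.range n, ‖mehlerIntegrand w x y k p‖ ≤
      Real.exp (-(π ^ 2 * (1 - ‖w‖)) * p.1 ^ 2) * Real.exp (-(π ^ 2 * (1 - ‖w‖)) * p.2 ^ 2) := by
  have hterm (k : ℕ) : ‖mehlerIntegrand w x y k p‖ =
      (2 * π ^ 2 * ‖w‖ * |p.1| * |p.2|) ^ k / k ! *
        Real.exp (-π ^ 2 * (p.1 ^ 2 + p.2 ^ 2)) := by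
    rw [mehlerIntegrand, norm_mul, norm_exp_mehler_phase, norm_div, norm_pow]
    simp [abs_of_pos Real.pi_pos]
  simp_rw [hterm]
  rw [← Finset.sum_mul, ← Real.exp_add]
  refine (mul_le_mul_of_nonneg_right (Real.sum_le_exp_of_nonneg (by positivity) n)
    (Real.exp_pos _).le).trans ?_
  rw [← Real.exp_add, Real.exp_le_exp]
  have h := mul_nonneg (mul_nonneg (sq_nonneg π) (norm_nonneg w)) (sq_nonneg (|p.1| - |p.2|))
  rw [sub_sq, sq_abs, sq_abs] at h
  linarith

theorem integrable_mehler_majorant {w : ℂ} (hw : ‖w‖ < 1) :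
    Integrable fun p : ℝ × ℝ => Real.exp (-(π ^ 2 * (1 - ‖w‖)) * p.1 ^ 2) *
      Real.exp (-(π ^ 2 * (1 - ‖w‖)) * p.2 ^ 2) := by
  have hb : 0 < π ^ 2 * (1 - ‖w‖) := mul_pos (by positivity) (sub_pos.2 hw)
  exact (integrable_exp_neg_mul_sq hb).mul_prod (integrable_exp_neg_mul_sq hb)

theorem continuous_mehlerIntegrand (w : ℂ) (x y : ℝ) (k : ℕ) :
    Continuous (mehlerIntegrand w x y k) := by
  unfold mehlerIntegrand
  fun_prop

theorem norm_mehlerIntegrand_le (w : ℂ) (x y : ℝ) (p : ℝ × ℝ) (k : ℕ) :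
    ‖mehlerIntegrand w x y k p‖ ≤
      Real.exp (-(π ^ 2 * (1 - ‖w‖)) * p.1 ^ 2) * Real.exp (-(π ^ 2 * (1 - ‖w‖)) * p.2 ^ 2) :=
  (Finset.single_le_sum (f := fun k => ‖mehlerIntegrand w x y k p‖)
    (fun _ _ => norm_nonneg _) (Finset.self_mem_range_succ k)).trans
    (sum_norm_mehlerIntegrand_le w x y p (k + 1))

theorem integrable_mehlerIntegrand {w : ℂ} (hw : ‖w‖ < 1) (x y : ℝ) (k : ℕ) :
    Integrable (mehlerIntegrand w x y k) :=
  (integrable_mehler_majorant hw).mono' (continuous_mehlerIntegrand w x y k).aestronglyMeasurable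
    (.of_forall fun p => norm_mehlerIntegrand_le w x y p k)

theorem summable_integral_norm_mehlerIntegrand {w : ℂ} (hw : ‖w‖ < 1) (x y : ℝ) :
    Summable fun k => ∫ p, ‖mehlerIntegrand w x y k p‖ := by
  refine summable_of_sum_range_le
    (c := ∫ p : ℝ × ℝ, Real.exp (-(π ^ 2 * (1 - ‖w‖)) * p.1 ^ 2) *
      Real.exp (-(π ^ 2 * (1 - ‖w‖)) * p.2 ^ 2))
    (fun k => integral_nonneg fun p => norm_nonneg _) fun n => ?_
  rw [← integral_finsetSum _ fun k _ => (integrable_mehlerIntegrand hw x y k).norm]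
  exact integral_mono (integrable_finsetSum _ fun k _ =>
      (integrable_mehlerIntegrand hw x y k).norm)
    (integrable_mehler_majorant hw) fun p => sum_norm_mehlerIntegrand_le w x y p n

theorem norm_exp_mehler_kernel_le (w : ℂ) (x y : ℝ) (p : ℝ × ℝ) :
    ‖cexp (-π ^ 2 * (p.1 ^ 2 + p.2 ^ 2) - 2 * π ^ 2 * w * p.1 * p.2 -
        2 * π * I * (x * p.1 + y * p.2))‖ ≤
      Real.exp (-(π ^ 2 * (1 - ‖w‖)) * p.1 ^ 2) * Real.exp (-(π ^ 2 * (1 - ‖w‖)) * p.2 ^ 2) := by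
  refine le_of_tendsto (hasSum_mehlerIntegrand w x y p).tendsto_sum_nat.norm (.of_forall fun n => ?_)
  exact (norm_sum_le _ _).trans (sum_norm_mehlerIntegrand_le w x y p n)

theorem re_one_sub_sq_pos {w : ℂ} (hw : ‖w‖ < 1) : 0 < (1 - w ^ 2).re := by
  have h : (w ^ 2).re ≤ ‖w‖ ^ 2 := (re_le_norm _).trans (norm_pow w 2).le
  rw [sub_re, one_re]
  nlinarith [norm_nonneg w]

theorem ofReal_mul_cpow {r : ℝ} (hr : 0 < r) {u : ℂ} (hu : u ≠ 0) (a : ℂ) :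
    ((r : ℂ) * u) ^ a = (r : ℂ) ^ a * u ^ a := by
  have hr' : (r : ℂ) ≠ 0 := ofReal_ne_zero.2 hr.ne'
  rw [cpow_def_of_ne_zero (mul_ne_zero hr' hu), cpow_def_of_ne_zero hr', cpow_def_of_ne_zero hu,
    log_ofReal_mul hr hu, add_mul, Complex.exp_add, ofReal_log hr.le]

theorem integral_mehler_kernel {w : ℂ} (hw : ‖w‖ < 1) (x y : ℝ) :
    π * cexp (x ^ 2 + y ^ 2) * ∫ p : ℝ × ℝ, cexp (-π ^ 2 * (p.1 ^ 2 + p.2 ^ 2) -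
        2 * π ^ 2 * w * p.1 * p.2 - 2 * π * I * (x * p.1 + y * p.2)) =
      (1 - w ^ 2) ^ (-(1 : ℂ) / 2) *
        cexp ((2 * x * y * w - (x ^ 2 + y ^ 2) * w ^ 2) / (1 - w ^ 2)) := by
  have hre := re_one_sub_sq_pos hw
  have hne : 1 - w ^ 2 ≠ 0 := fun h => by simp [h] at hre
  have hπ : (π : ℂ) ≠ 0 := by exact_mod_cast Real.pi_ne_zero
  have hinner (s : ℝ) : ∫ t : ℝ, cexp (-π ^ 2 * (s ^ 2 + t ^ 2) -
        2 * π ^ 2 * w * s * t - 2 * π * I * (x * s + y * t)) =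
      (π⁻¹ : ℂ) ^ (1 / 2 : ℂ) * cexp (-(π ^ 2 * (1 - w ^ 2)) * s ^ 2 +
        (2 * π * I * (w * y - x)) * s + -y ^ 2) := by
    have h := integral_cexp_quadratic (b := -π ^ 2) (by
      rw [← ofReal_pow, ← ofReal_neg, ofReal_re]; exact neg_lt_zero.2 (by positivity))
      (-2 * π ^ 2 * w * s - 2 * π * I * y) (-π ^ 2 * s ^ 2 - 2 * π * I * x * s)
    convert! h using 3
    · ring_nf
    · field_simp
    · field_simp
      linear_combination (-4 * y ^ 2) * I_sq
  rw [Measure.volume_eq_prod, integral_prod]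
  · simp only [hinner]
    have hb : (-((π : ℂ) ^ 2 * (1 - w ^ 2))).re < 0 := by
      rw [← ofReal_pow, neg_re, re_ofReal_mul]
      exact neg_lt_zero.2 (mul_pos (by positivity) hre)
    have harg : (1 - w ^ 2).arg ≠ π := fun h => by
      linarith [(arg_eq_pi_iff.1 h).1]
    have hroot : (π / - -((π : ℂ) ^ 2 * (1 - w ^ 2))) ^ (1 / 2 : ℂ) =
        (π⁻¹ : ℂ) ^ (1 / 2 : ℂ) * (1 - w ^ 2) ^ (-(1 : ℂ) / 2) := by
      have : π / - -((π : ℂ) ^ 2 * (1 - w ^ 2)) = ((π⁻¹ : ℝ) : ℂ) * (1 - w ^ 2)⁻¹ := by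
        push_cast
        field_simp
      rw [this, ofReal_mul_cpow (inv_pos.2 Real.pi_pos) (inv_ne_zero hne), inv_cpow _ _ harg,
        ← cpow_neg, ofReal_inv, neg_div]
    have hhalf : (π⁻¹ : ℂ) ^ (1 / 2 : ℂ) * (π⁻¹ : ℂ) ^ (1 / 2 : ℂ) = (π : ℂ)⁻¹ := by
      rw [← cpow_add _ _ (inv_ne_zero hπ)]
      norm_num
    have hexp : (2 * x * y * w - (x ^ 2 + y ^ 2) * w ^ 2) / (1 - w ^ 2) = x ^ 2 + y ^ 2 +
        (-y ^ 2 - (2 * π * I * (w * y - x)) ^ 2 / (4 * -(π ^ 2 * (1 - w ^ 2)))) := by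
      field_simp
      linear_combination (-4 * (w * y - x) ^ 2) * I_sq
    rw [integral_const_mul, integral_cexp_quadratic hb, hroot, hexp,
      Complex.exp_add (x ^ 2 + y ^ 2) (-y ^ 2 - _)]
    generalize cexp (-y ^ 2 - _) = E
    linear_combination (π * cexp (x ^ 2 + y ^ 2) * (1 - w ^ 2) ^ (-(1 : ℂ) / 2) * E) * hhalf +
      (cexp (x ^ 2 + y ^ 2) * (1 - w ^ 2) ^ (-(1 : ℂ) / 2) * E) * mul_inv_cancel₀ hπ
  · exact (integrable_mehler_majorant hw).mono' (by fun_prop)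
      (.of_forall fun p => norm_exp_mehler_kernel_le w x y p)

theorem hasSum_mehler {w : ℂ} (hw : ‖w‖ < 1) (x y : ℝ) :
    HasSum (fun k : ℕ => w ^ k * (normHermite k x : ℂ) * (normHermite k y : ℂ))
      ((1 - w ^ 2) ^ (-(1 : ℂ) / 2) *
        cexp ((2 * x * y * w - (x ^ 2 + y ^ 2) * w ^ 2) / (1 - w ^ 2))) := by
  have h := (hasSum_integral_of_summable_integral_norm (integrable_mehlerIntegrand hw x y)
    (summable_integral_norm_mehlerIntegrand hw x y)).mul_left (π * cexp (x ^ 2 + y ^ 2))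
  simp only [(hasSum_mehlerIntegrand w x y _).tsum_eq, integral_mehlerIntegrand,
    integral_mehler_kernel hw] at h
  exact h

theorem summable_norm_mehler {w : ℂ} (hw : ‖w‖ < 1) (x y : ℝ) :
    Summable fun k : ℕ => ‖w ^ k * (normHermite k x : ℂ) * (normHermite k y : ℂ)‖ := by
  simp only [← integral_mehlerIntegrand, norm_mul _ (∫ p, _)]
  exact (Summable.of_nonneg_of_le (fun k => norm_nonneg _)
    (fun k => norm_integral_le_integral_norm _)
    (summable_integral_norm_mehlerIntegrand hw x y)).mul_left _

/-- Mehler's formula. -/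
theorem mehler_formula (z : ℂ) (hz : 0 < z.re) (x y : ℝ) :
    Summable (fun k : ℕ =>
      ‖Complex.exp (-(k : ℂ) * z) * (normHermite k x : ℂ) * (normHermite k y : ℂ)‖) ∧
    (∑' k : ℕ, Complex.exp (-(k : ℂ) * z) * (normHermite k x : ℂ) * (normHermite k y : ℂ)) =
      (1 - Complex.exp (-(2 * z))) ^ (-(1 : ℂ) / 2) *
        Complex.exp
          (((1 - Complex.cosh z / Complex.sinh z) * ((x : ℂ) ^ 2 + (y : ℂ) ^ 2) +
              2 * (x : ℂ) * (y : ℂ) / Complex.sinh z) / 2) := by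
  have hw : ‖cexp (-z)‖ < 1 := by simpa [Complex.norm_exp] using hz
  have hpow (k : ℕ) : cexp (-(k : ℂ) * z) = cexp (-z) ^ k := by
    rw [← Complex.exp_nat_mul]; ring_nf
  have hsq : cexp (-(2 * z)) = cexp (-z) ^ 2 := by
    rw [← Complex.exp_nat_mul]; push_cast; ring_nf
  have hne : 1 - cexp (-z) ^ 2 ≠ 0 := fun h => by
    simpa [h] using re_one_sub_sq_pos hw
  have hinv : cexp z = (cexp (-z))⁻¹ := by rw [Complex.exp_neg, inv_inv]
  have hexp0 := Complex.exp_ne_zero (-z)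
  simp only [hpow, hsq]
  refine ⟨summable_norm_mehler hw x y, ?_⟩
  rw [(hasSum_mehler hw x y).tsum_eq, Complex.cosh, Complex.sinh, hinv]
  congr 2
  generalize cexp (-z) = w at hne hexp0
  have hsinh : (w⁻¹ - w) / 2 = (1 - w ^ 2) / (2 * w) := by field_simp
  have hcosh : (w⁻¹ + w) / 2 = (1 + w ^ 2) / (2 * w) := by field_simp
  rw [hsinh, hcosh]
  field_simp
  ring
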